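/- Let F be a cumulative distribution function, F̃(z) = 1 − F(z), and ω_F = sup{z : F̃(z) > 0}. For μ > 0, F belongs to the domain of attraction of the Fréchet distribution H_{f,μ} — i.e., there exist a_N ∈ ℝ and b_N > 0 such that F(a_N + b_N x)^N converges at every continuity point to H_{f,μ}(x) — if and only if ω_F = +∞ and for all x > 0, lim_{t→∞} F̃(tx)/F̃(t) = x^{−μ}. -/

import Mathlib

open MeasureTheory Filter

/-- A cumulative distribution function: monotone, right-continuous, with limits 0 at `-∞`
and 1 at `+∞`. -/
def IsCDF (F : ℝ → ℝ) : Prop :=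
  Monotone F ∧ (∀ x, ContinuousWithinAt F (Set.Ici x) x) ∧
    Tendsto F atBot (nhds 0) ∧ Tendsto F atTop (nhds 1)

/-- The Fréchet distribution with index `μ > 0`: `H_{f,μ}(x) = exp(−x^{−μ})` for `x > 0`,
and `0` for `x ≤ 0`. -/
noncomputable def frechetCDF (μ x : ℝ) : ℝ :=
  if 0 < x then Real.exp (-x ^ (-μ)) else 0

/-- If antitone functions converge pointwise on `(0, ∞)` to `y ↦ y ^ (-μ)`, then they converge
continuously there: the arguments may vary along a convergent family. -/
lemma tendsto_antitone_apply_rpow {ι : Type*} {l : Filter ι} {G : ι → ℝ → ℝ} {μ : ℝ}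
    (hG : ∀ i, Antitone (G i))
    (hlim : ∀ y : ℝ, 0 < y → Tendsto (fun i => G i y) l (nhds (y ^ (-μ))))
    {s : ι → ℝ} {x : ℝ} (hx : 0 < x) (hs : Tendsto s l (nhds x)) :
    Tendsto (fun i => G i (s i)) l (nhds (x ^ (-μ))) := by
  have hc : Tendsto (fun y : ℝ => y ^ (-μ)) (nhds x) (nhds (x ^ (-μ))) :=
    (Real.continuousAt_rpow_const x (-μ) (Or.inl hx.ne')).tendsto
  refine tendsto_order.2 ⟨fun a ha => ?_, fun a ha => ?_⟩
  · have h1 : ∀ᶠ y in nhdsWithin x (Set.Ioi x), a < y ^ (-μ) :=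
      (hc.mono_left nhdsWithin_le_nhds).eventually (lt_mem_nhds ha)
    obtain ⟨y, hy, hxy⟩ := (h1.and self_mem_nhdsWithin).exists
    have hxy : x < y := hxy
    filter_upwards [(hlim y (hx.trans hxy)).eventually (lt_mem_nhds hy),
      hs.eventually (gt_mem_nhds hxy)] with i h2 h3
    exact h2.trans_le (hG i h3.le)
  · have h1 : ∀ᶠ y in nhdsWithin x (Set.Iio x), y ^ (-μ) < a :=
      (hc.mono_left nhdsWithin_le_nhds).eventually (gt_mem_nhds ha)
    have h0 : ∀ᶠ y in nhdsWithin x (Set.Iio x), 0 < y :=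
      nhdsWithin_le_nhds (lt_mem_nhds hx)
    obtain ⟨y, ⟨hy, hy0⟩, hxy⟩ := ((h1.and h0).and self_mem_nhdsWithin).exists
    have hxy : y < x := hxy
    filter_upwards [(hlim y hy0).eventually (gt_mem_nhds hy),
      hs.eventually (lt_mem_nhds hxy)] with i h2 h3
    exact (hG i h3.le).trans_lt h2

/-- If `u N ^ N → exp (-c)` with `u ≥ 0`, then `N * (1 - u N) → c`. -/
lemma tendsto_mul_one_sub_of_tendsto_pow {u : ℕ → ℝ} {c : ℝ} (hu : ∀ N, 0 ≤ u N)
    (h : Tendsto (fun N => u N ^ N) atTop (nhds (Real.exp (-c)))) :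
    Tendsto (fun N : ℕ => (N : ℝ) * (1 - u N)) atTop (nhds c) := by
  have hlog : Tendsto (fun N : ℕ => (N : ℝ) * Real.log (u N)) atTop (nhds (-c)) := by
    have := (Real.continuousAt_log (Real.exp_pos (-c)).ne').tendsto.comp h
    simpa [Function.comp_def, Real.log_pow] using this
  have hpos : ∀ᶠ N in atTop, 0 < u N := by
    filter_upwards [h.eventually (lt_mem_nhds (Real.exp_pos (-c))), eventually_gt_atTop 0]
      with N hN hN0
    refine (hu N).lt_of_ne fun h0 => ?_
    rw [← h0, zero_pow hN0.ne'] at hN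
    exact lt_irrefl _ hN
  have hlog0 : Tendsto (fun N : ℕ => Real.log (u N)) atTop (nhds 0) := by
    have := hlog.mul (tendsto_inv_atTop_nhds_zero_nat (𝕜 := ℝ))
    rw [mul_zero] at this
    refine this.congr' ?_
    filter_upwards [eventually_gt_atTop 0] with N hN
    have : (N : ℝ) ≠ 0 := by positivity
    field_simp
  have hu1 : Tendsto u atTop (nhds 1) := by
    have := (Real.continuous_exp.tendsto 0).comp hlog0
    rw [Real.exp_zero] at this
    refine this.congr' ?_
    filter_upwards [hpos] with N hN
    exact Real.exp_log hN
  have hup : Tendsto (fun N : ℕ => -((N : ℝ) * Real.log (u N))) atTop (nhds c) := by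
    simpa using hlog.neg
  have hlow : Tendsto (fun N : ℕ => u N * -((N : ℝ) * Real.log (u N))) atTop (nhds c) := by
    simpa using hu1.mul hup
  refine tendsto_of_tendsto_of_tendsto_of_le_of_le' hlow hup ?_ ?_
  · filter_upwards [hpos] with N hN
    have h1 := Real.one_sub_inv_le_log_of_pos hN
    have h2 : u N * (1 - (u N)⁻¹) ≤ u N * Real.log (u N) :=
      mul_le_mul_of_nonneg_left h1 hN.le
    rw [mul_sub, mul_inv_cancel₀ hN.ne'] at h2
    have h3 := mul_le_mul_of_nonneg_left h2 (Nat.cast_nonneg (α := ℝ) N)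
    linarith
  · filter_upwards [hpos] with N hN
    have h1 := Real.log_le_sub_one_of_pos hN
    have h3 := mul_le_mul_of_nonneg_left h1 (Nat.cast_nonneg (α := ℝ) N)
    linarith

/-- A perturbed contraction tends to zero. -/
lemma tendsto_zero_of_eventually_le_mul_add {r e : ℕ → ℝ} {θ : ℝ} (hr : ∀ n, 0 ≤ r n)
    (hθ0 : 0 ≤ θ) (hθ1 : θ < 1) (he : Tendsto e atTop (nhds 0))
    (h : ∀ᶠ n in atTop, r (n + 1) ≤ θ * r n + e n) : Tendsto r atTop (nhds 0) := by
  refine tendsto_order.2 ⟨fun a ha => Eventually.of_forall fun n => ha.trans_le (hr n),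
    fun a ha => ?_⟩
  have hε : 0 < (1 - θ) * (a / 2) := by
    have : 0 < 1 - θ := by linarith
    positivity
  obtain ⟨n₀, hn₀⟩ := eventually_atTop.1 (h.and (he.eventually (gt_mem_nhds hε)))
  have key : ∀ k, r (n₀ + k) - a / 2 ≤ θ ^ k * r n₀ := by
    intro k
    induction k with
    | zero => simp; linarith
    | succ k ih =>
      obtain ⟨h1, h2⟩ := hn₀ (n₀ + k) (by omega)
      have h3 := mul_le_mul_of_nonneg_left ih hθ0
      rw [← add_assoc, pow_succ]
      linarith
  have hz : Tendsto (fun k => θ ^ k * r n₀) atTop (nhds 0) := by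
    simpa using (tendsto_pow_atTop_nhds_zero_of_lt_one hθ0 hθ1).mul_const (r n₀)
  have hk : ∀ᶠ k in atTop, r (k + n₀) < a := by
    filter_upwards [hz.eventually (gt_mem_nhds (half_pos ha))] with k hk
    have := key k
    rw [add_comm] at this
    linarith
  obtain ⟨K, hK⟩ := eventually_atTop.1 hk
  refine eventually_atTop.2 ⟨K + n₀, fun n hn => ?_⟩
  have := hK (n - n₀) (by omega)
  rwa [Nat.sub_add_cancel (by omega)] at this

/-- A sequence of positive reals whose successive ratios converge to `α > 1` tends to `∞`. -/
lemma tendsto_atTop_of_tendsto_ratio {B : ℕ → ℝ} {α : ℝ} (hB : ∀ n, 0 < B n) (hα : 1 < α)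
    (h : Tendsto (fun n => B (n + 1) / B n) atTop (nhds α)) : Tendsto B atTop atTop := by
  obtain ⟨c, hc1, hcα⟩ := exists_between hα
  obtain ⟨n₀, hn₀⟩ := eventually_atTop.1 (h.eventually (lt_mem_nhds hcα))
  refine (tendsto_add_atTop_iff_nat n₀).1 ?_
  refine tendsto_atTop_of_geom_le (hB _) hc1 fun n => ?_
  have := hn₀ (n + n₀) (by omega)
  rw [lt_div_iff₀ (hB _)] at this
  rw [show n + 1 + n₀ = n + n₀ + 1 by omega]
  exact this.le

/-- Comparison of the affine normalisations at two indices where the tails differ by a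
factor two. -/
lemma tendsto_affine_ratio {T : ℝ → ℝ} {μ : ℝ} (hμ : 0 < μ) (hT : Antitone T)
    {A B : ℕ → ℝ} (hB : ∀ n, 0 < B n)
    (h : ∀ x : ℝ, 0 < x →
      Tendsto (fun n : ℕ => (2 : ℝ) ^ n * T (A n + B n * x)) atTop (nhds (x ^ (-μ))))
    {x : ℝ} (hx : 0 < x) :
    Tendsto (fun n => (A (n + 1) - A n) / B n + B (n + 1) / B n * x) atTop
      (nhds ((2 : ℝ) ^ (1 / μ) * x)) := by
  set α : ℝ := (2 : ℝ) ^ (1 / μ) with hα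
  have hα0 : 0 < α := by positivity
  have hαμ : α ^ (-μ) = 1 / 2 := by
    rw [hα, ← Real.rpow_mul (by norm_num)]
    rw [show 1 / μ * -μ = -1 by field_simp, Real.rpow_neg_one]
    norm_num
  have hnext : Tendsto (fun n : ℕ => (2 : ℝ) ^ n * T (A (n + 1) + B (n + 1) * x)) atTop
      (nhds ((α * x) ^ (-μ))) := by
    rw [Real.mul_rpow hα0.le hx.le, hαμ]
    have := ((tendsto_add_atTop_iff_nat 1).2 (h x hx)).const_mul (1 / 2 : ℝ)
    refine this.congr fun n => ?_
    rw [pow_succ]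
    ring
  have hαx : 0 < α * x := by positivity
  have hrw : ∀ n, (A (n + 1) - A n) / B n + B (n + 1) / B n * x
      = (A (n + 1) + B (n + 1) * x - A n) / B n := fun n => by ring
  simp only [hrw]
  refine tendsto_order.2 ⟨fun y hy => ?_, fun y hy => ?_⟩
  · obtain ⟨z, hz1, hz2⟩ := exists_between (max_lt hy hαx)
    have hz0 : 0 < z := (le_max_right _ _).trans_lt hz1
    have hlt : (α * x) ^ (-μ) < z ^ (-μ) := Real.rpow_lt_rpow_of_neg hz0 hz2 (by linarith)
    filter_upwards [hnext.eventually_lt (h z hz0) hlt] with n hn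
    have hn' := lt_of_mul_lt_mul_left hn (by positivity)
    have := hT.reflect_lt hn'
    rw [lt_div_iff₀ (hB n)]
    have := mul_lt_mul_of_pos_right ((le_max_left _ _).trans_lt hz1) (hB n)
    linarith
  · have hy0 : 0 < y := hαx.trans hy
    have hlt : y ^ (-μ) < (α * x) ^ (-μ) := Real.rpow_lt_rpow_of_neg hαx hy (by linarith)
    filter_upwards [(h y hy0).eventually_lt hnext hlt] with n hn
    have hn' := lt_of_mul_lt_mul_left hn (by positivity)
    have := hT.reflect_lt hn'
    rw [div_lt_iff₀ (hB n)]
    linarith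

/-- The centring constants may be dropped: if the dyadic tails converge after an affine
normalisation, then the scales tend to infinity with ratio `2 ^ (1 / μ)` and the tails converge
after scaling only. -/
lemma tendsto_tail_without_centring {T : ℝ → ℝ} {μ : ℝ} (hμ : 0 < μ) (hT : Antitone T)
    {A B : ℕ → ℝ} (hB : ∀ n, 0 < B n)
    (h : ∀ x : ℝ, 0 < x →
      Tendsto (fun n : ℕ => (2 : ℝ) ^ n * T (A n + B n * x)) atTop (nhds (x ^ (-μ)))) :
    Tendsto (fun n => B (n + 1) / B n) atTop (nhds ((2 : ℝ) ^ (1 / μ))) ∧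
      Tendsto B atTop atTop ∧
      ∀ x : ℝ, 0 < x →
        Tendsto (fun n : ℕ => (2 : ℝ) ^ n * T (B n * x)) atTop (nhds (x ^ (-μ))) := by
  have h1 := tendsto_affine_ratio hμ hT hB h one_pos
  have h2 := tendsto_affine_ratio hμ hT hB h two_pos
  set α : ℝ := (2 : ℝ) ^ (1 / μ) with hα
  have hα1 : 1 < α := Real.one_lt_rpow (by norm_num) (by positivity)
  have hp : Tendsto (fun n => B (n + 1) / B n) atTop (nhds α) := by
    have := h2.sub h1
    ring_nf at this
    refine (this.congr fun n => ?_)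
    ring_nf
  have hq : Tendsto (fun n => (A (n + 1) - A n) / B n) atTop (nhds 0) := by
    have := h1.sub hp
    simpa using this
  have hBtop := tendsto_atTop_of_tendsto_ratio hB hα1 hp
  have hr : Tendsto (fun n => A n / B n) atTop (nhds 0) := by
    obtain ⟨c, hc1, hcα⟩ := exists_between hα1
    refine (tendsto_zero_iff_abs_tendsto_zero _).2 ?_
    refine tendsto_zero_of_eventually_le_mul_add (θ := c⁻¹)
      (e := fun n => |(A (n + 1) - A n) / B n|) (fun n => abs_nonneg _) (by positivity)
      (inv_lt_one_of_one_lt₀ hc1) (by simpa using hq.abs) ?_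
    filter_upwards [hp.eventually (lt_mem_nhds hcα)] with n hn
    have hBn := hB n
    have hBn1 := hB (n + 1)
    have e1 : A (n + 1) / B (n + 1)
        = (A n / B n + (A (n + 1) - A n) / B n) * (B (n + 1) / B n)⁻¹ := by
      field_simp
      ring
    have e2 : (B (n + 1) / B n)⁻¹ ≤ c⁻¹ := inv_anti₀ (by linarith) hn.le
    have e3 : c⁻¹ ≤ 1 := (inv_lt_one_of_one_lt₀ hc1).le
    have e4 : 0 ≤ c⁻¹ := by positivity
    simp only [Function.comp_apply]
    rw [e1, abs_mul, abs_of_pos (show 0 < (B (n + 1) / B n)⁻¹ by positivity)]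
    calc _ ≤ (|A n / B n| + |(A (n + 1) - A n) / B n|) * c⁻¹ := by
            gcongr
            exact abs_add_le _ _
      _ ≤ _ := by
            have := mul_le_mul_of_nonneg_left e3 (abs_nonneg ((A (n + 1) - A n) / B n))
            linarith
  refine ⟨hp, hBtop, fun x hx => ?_⟩
  have hs : Tendsto (fun n => x - A n / B n) atTop (nhds x) := by
    simpa using hr.const_sub x
  have := tendsto_antitone_apply_rpow (G := fun (n : ℕ) y => (2 : ℝ) ^ n * T (A n + B n * y))
    (fun n y z hyz => by
      have := hT (add_le_add_right (mul_le_mul_of_nonneg_left hyz (hB n).le) (A n))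
      exact mul_le_mul_of_nonneg_left this (by positivity)) h hx hs
  refine this.congr fun n => ?_
  have : B n ≠ 0 := (hB n).ne'
  congr 2
  field_simp
  ring

/-- Every large real lies between two consecutive terms of a sequence tending to `∞`, the index
tending to `∞` with it. -/
lemma exists_index_between {B : ℕ → ℝ} (hB : Tendsto B atTop atTop) :
    ∃ n : ℝ → ℕ, Tendsto n atTop atTop ∧ ∀ᶠ t in atTop, B (n t) ≤ t ∧ t < B (n t + 1) := by
  have hex : ∀ t : ℝ, ∃ n, B 0 ≤ t → B n ≤ t ∧ t < B (n + 1) := by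
    intro t
    by_cases h0 : B 0 ≤ t
    · by_contra! hcon
      have hall : ∀ n, B n ≤ t := by
        intro n
        induction n with
        | zero => exact h0
        | succ n ih => exact (hcon n).2 ih
      obtain ⟨n, hn⟩ := (hB.eventually (eventually_gt_atTop t)).exists
      exact (hall n).not_gt hn
    · exact ⟨0, fun h => absurd h h0⟩
  choose n hn using hex
  refine ⟨n, tendsto_atTop.2 fun m => ?_, ?_⟩
  · have hall : ∀ᶠ t : ℝ in atTop, ∀ k ∈ Finset.range (m + 1), B k ≤ t :=
      (Finset.eventually_all _).2 fun k _ => eventually_ge_atTop _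
    filter_upwards [hall] with t ht
    have h0 := (hn t (ht 0 (by simp))).2
    by_contra! hlt
    exact (ht (n t + 1) (by simp; omega)).not_gt h0
  · filter_upwards [eventually_ge_atTop (B 0)] with t ht using hn t ht

/-- Convergence of the scaled dyadic tails implies regular variation of the tail. -/
lemma tendsto_tail_ratio {T : ℝ → ℝ} {μ : ℝ} (hT : Antitone T)
    {B : ℕ → ℝ} {α : ℝ} (hB : ∀ n, 0 < B n)
    (hp : Tendsto (fun n => B (n + 1) / B n) atTop (nhds α)) (hBtop : Tendsto B atTop atTop)
    (h : ∀ x : ℝ, 0 < x →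
      Tendsto (fun n : ℕ => (2 : ℝ) ^ n * T (B n * x)) atTop (nhds (x ^ (-μ))))
    {x : ℝ} (hx : 0 < x) :
    Tendsto (fun t : ℝ => T (t * x) / T t) atTop (nhds (x ^ (-μ))) := by
  obtain ⟨n, hntop, hn⟩ := exists_index_between hBtop
  have hmem : ∀ᶠ t in atTop, t / B (n t) ∈ Set.Icc 1 (α + 1) := by
    have := (hp.comp hntop).eventually (gt_mem_nhds (lt_add_one α))
    filter_upwards [hn, this] with t ht ht2
    refine ⟨(one_le_div (hB _)).2 ht.1, ?_⟩
    exact ((div_le_div_of_nonneg_right ht.2.le (hB _).le).trans_lt ht2).le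
  refine tendsto_iff_ultrafilter _ _ _ |>.2 fun U hU => ?_
  obtain ⟨s, hs, hUs⟩ := (isCompact_Icc (a := (1 : ℝ)) (b := α + 1)).ultrafilter_le_nhds
    (U.map fun t => t / B (n t)) (le_principal_iff.2 (hU hmem))
  have hUs : Tendsto (fun t => t / B (n t)) U (nhds s) := hUs
  have hs0 : 0 < s := one_pos.trans_le hs.1
  have hG : ∀ t, Antitone fun y => (2 : ℝ) ^ n t * T (B (n t) * y) := fun t y z hyz => by
    have := hT (mul_le_mul_of_nonneg_left hyz (hB (n t)).le)
    exact mul_le_mul_of_nonneg_left this (by positivity)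
  have hlim : ∀ y : ℝ, 0 < y →
      Tendsto (fun t => (2 : ℝ) ^ n t * T (B (n t) * y)) U (nhds (y ^ (-μ))) :=
    fun y hy => (h y hy).comp (hntop.mono_left hU)
  have hnum := tendsto_antitone_apply_rpow hG hlim (mul_pos hs0 hx) (hUs.mul_const x)
  have hden := tendsto_antitone_apply_rpow hG hlim hs0 hUs
  have hquot := hnum.div hden (Real.rpow_pos_of_pos hs0 _).ne'
  rw [Real.mul_rpow hs0.le hx.le, mul_div_cancel_left₀ _ (Real.rpow_pos_of_pos hs0 _).ne']
    at hquot
  refine hquot.congr fun t => ?_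
  have hBt : B (n t) ≠ 0 := (hB _).ne'
  have e1 : B (n t) * (t / B (n t) * x) = t * x := by field_simp
  have e2 : B (n t) * (t / B (n t)) = t := by field_simp
  simp only [Pi.div_apply, e1, e2]
  exact mul_div_mul_left _ _ (by positivity)

lemma IsCDF.nonneg {F : ℝ → ℝ} (hF : IsCDF F) (x : ℝ) : 0 ≤ F x :=
  hF.1.le_of_tendsto hF.2.2.1 x

lemma IsCDF.le_one {F : ℝ → ℝ} (hF : IsCDF F) (x : ℝ) : F x ≤ 1 :=
  hF.1.ge_of_tendsto hF.2.2.2 x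

lemma IsCDF.antitone_tail {F : ℝ → ℝ} (hF : IsCDF F) : Antitone fun x => 1 - F x :=
  fun _ _ h => sub_le_sub_left (hF.1 h) 1

/-- Existence of tail quantiles. -/
lemma IsCDF.exists_quantile {F : ℝ → ℝ} (hF : IsCDF F) {ε : ℝ} (hε : 0 < ε)
    (hε0 : ε < 1 - F 0) :
    ∃ t, 0 < t ∧ 1 - F t ≤ ε ∧ ∀ s < t, ε < 1 - F s := by
  set S : Set ℝ := {t | 1 - F t ≤ ε} with hS
  have hne : S.Nonempty := by
    obtain ⟨t, ht⟩ := (hF.2.2.2.eventually (lt_mem_nhds (show 1 - ε < 1 by linarith))).exists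
    exact ⟨t, by simp only [hS, Set.mem_ofPred_eq]; linarith⟩
  have hpos : ∀ t ∈ S, 0 < t := fun t ht => by
    by_contra! hle
    have := hF.1 hle
    simp only [hS, Set.mem_ofPred_eq] at ht
    linarith
  have hbdd : BddBelow S := ⟨0, fun t ht => (hpos t ht).le⟩
  have hinf : sInf S ∈ S := by
    have hc : Tendsto (fun t => 1 - F t) (nhdsWithin (sInf S) (Set.Ioi (sInf S)))
        (nhds (1 - F (sInf S))) :=
      ((hF.2.1 (sInf S)).mono Set.Ioi_subset_Ici_self).tendsto.const_sub 1
    refine le_of_tendsto hc ?_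
    filter_upwards [self_mem_nhdsWithin] with t ht
    obtain ⟨s, hs, hst⟩ := (csInf_lt_iff hbdd hne).1 ht
    exact (hF.antitone_tail hst.le).trans hs
  refine ⟨sInf S, hpos _ hinf, hinf, fun s hs => ?_⟩
  by_contra! hle
  exact (csInf_le hbdd (show s ∈ S from hle)).not_gt hs

lemma IsCDF.tail_pos {F : ℝ → ℝ} (hF : IsCDF F) (hunb : ¬ BddAbove {z : ℝ | 0 < 1 - F z})
    (t : ℝ) : 0 < 1 - F t := by
  obtain ⟨z, hz, htz⟩ := not_bddAbove_iff.1 hunb t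
  exact lt_of_lt_of_le hz (hF.antitone_tail htz.le)

lemma frechetCDF_of_pos {μ x : ℝ} (hx : 0 < x) : frechetCDF μ x = Real.exp (-x ^ (-μ)) :=
  if_pos hx

lemma continuousAt_frechetCDF_of_pos {μ x : ℝ} (hx : 0 < x) :
    ContinuousAt (frechetCDF μ) x := by
  have h : ContinuousAt (fun y : ℝ => Real.exp (-y ^ (-μ))) x :=
    Real.continuous_exp.continuousAt.comp
      (Real.continuousAt_rpow_const x (-μ) (Or.inl hx.ne')).neg
  refine h.congr ?_
  filter_upwards [lt_mem_nhds hx] with y hy using (frechetCDF_of_pos hy).symm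

/-- Regular variation of the tail gives convergence of the maxima, scaled by quantiles. -/
lemma IsCDF.exists_scale_of_regular_variation {F : ℝ → ℝ} (hF : IsCDF F) {μ : ℝ}
    (hunb : ¬ BddAbove {z : ℝ | 0 < 1 - F z})
    (hrv : ∀ x : ℝ, 0 < x →
      Tendsto (fun t : ℝ => (1 - F (t * x)) / (1 - F t)) atTop (nhds (x ^ (-μ)))) :
    ∃ b : ℕ → ℝ, (∀ N, 0 < b N) ∧ ∀ x : ℝ, 0 < x →
      Tendsto (fun N : ℕ => (N : ℝ) * (1 - F (b N * x))) atTop (nhds (x ^ (-μ))) := by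
  have hpos := hF.tail_pos hunb
  have hex : ∀ N : ℕ, ∃ t, 0 < t ∧ (0 < N → (N : ℝ)⁻¹ < 1 - F 0 →
      1 - F t ≤ (N : ℝ)⁻¹ ∧ ∀ s < t, (N : ℝ)⁻¹ < 1 - F s) := by
    intro N
    by_cases h : 0 < N ∧ (N : ℝ)⁻¹ < 1 - F 0
    · obtain ⟨t, ht, h1⟩ := hF.exists_quantile (by have := h.1; positivity) h.2
      exact ⟨t, ht, fun _ _ => h1⟩
    · exact ⟨1, one_pos, fun h1 h2 => absurd ⟨h1, h2⟩ h⟩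
  choose b hb hq using hex
  have hinv := tendsto_inv_atTop_nhds_zero_nat (𝕜 := ℝ)
  have hev : ∀ᶠ N : ℕ in atTop, 0 < N ∧
      1 - F (b N) ≤ (N : ℝ)⁻¹ ∧ ∀ s < b N, (N : ℝ)⁻¹ < 1 - F s := by
    filter_upwards [eventually_gt_atTop 0, hinv.eventually (gt_mem_nhds (hpos 0))] with N h1 h2
    exact ⟨h1, hq N h1 h2⟩
  have hbtop : Tendsto b atTop atTop := by
    refine tendsto_atTop.2 fun M => ?_
    filter_upwards [hev, hinv.eventually (gt_mem_nhds (hpos M))] with N h1 h2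
    by_contra! hlt
    have := hF.1 hlt.le
    linarith [h1.2.1]
  have hone : Tendsto (fun N : ℕ => (N : ℝ) * (1 - F (b N))) atTop (nhds 1) := by
    refine tendsto_order.2 ⟨fun a ha => ?_, fun a ha => ?_⟩
    · have hc : Tendsto (fun y : ℝ => (y ^ (-μ))⁻¹) (nhdsWithin 1 (Set.Iio 1)) (nhds 1) := by
        have : ContinuousAt (fun y : ℝ => (y ^ (-μ))⁻¹) 1 :=
          (Real.continuousAt_rpow_const 1 (-μ) (Or.inl one_ne_zero)).inv₀ (by simp)
        have h1 := this.tendsto.mono_left (nhdsWithin_le_nhds (s := Set.Iio 1))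
        simpa using h1
      have h0 : ∀ᶠ y : ℝ in nhdsWithin 1 (Set.Iio 1), 0 < y :=
        nhdsWithin_le_nhds (lt_mem_nhds one_pos)
      obtain ⟨y, ⟨hy, hy0⟩, hy1⟩ :=
        (((hc.eventually (lt_mem_nhds ha)).and h0).and self_mem_nhdsWithin).exists
      have hy1 : y < 1 := hy1
      have hlim := ((hrv y hy0).comp hbtop).inv₀ (Real.rpow_pos_of_pos hy0 _).ne'
      filter_upwards [hev, hlim.eventually (lt_mem_nhds hy)] with N h1 h2
      simp only [Function.comp_apply, inv_div] at h2
      have h3 := h1.2.2 (b N * y) (mul_lt_of_lt_one_right (hb N) hy1)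
      have hN : (0 : ℝ) < N := by exact_mod_cast h1.1
      refine h2.trans_le ?_
      rw [div_le_iff₀ (hpos _)]
      have h4 : 1 ≤ (N : ℝ) * (1 - F (b N * y)) := by
        have := mul_lt_mul_of_pos_left h3 hN
        rw [mul_inv_cancel₀ hN.ne'] at this
        exact this.le
      have := mul_le_mul_of_nonneg_left h4 (hpos (b N)).le
      linarith
    · filter_upwards [hev] with N h1
      have hN : (0 : ℝ) < N := by exact_mod_cast h1.1
      have := mul_le_mul_of_nonneg_left h1.2.1 hN.le
      rw [mul_inv_cancel₀ hN.ne'] at this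
      linarith
  refine ⟨b, hb, fun x hx => ?_⟩
  have := hone.mul ((hrv x hx).comp hbtop)
  rw [one_mul] at this
  refine this.congr fun N => ?_
  have := (hpos (b N)).ne'
  simp only [Function.comp_apply]
  field_simp

/-- If `N * (1 - u N) → c`, then `u N ^ N → exp (-c)`. -/
lemma tendsto_pow_of_tendsto_mul_one_sub {u : ℕ → ℝ} {c : ℝ}
    (h : Tendsto (fun N : ℕ => (N : ℝ) * (1 - u N)) atTop (nhds c)) :
    Tendsto (fun N => u N ^ N) atTop (nhds (Real.exp (-c))) := by
  have h' : Tendsto (fun N : ℕ => (N : ℝ) * (u N - 1)) atTop (nhds (-c)) :=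
    h.neg.congr fun N => by ring
  refine (Real.tendsto_one_add_pow_exp_of_tendsto h').congr fun N => ?_
  ring

/-- The Fréchet law vanishes at `0+`. -/
lemma tendsto_exp_neg_rpow_neg_zero {μ : ℝ} (hμ : 0 < μ) :
    Tendsto (fun y : ℝ => Real.exp (-y ^ (-μ))) (nhdsWithin 0 (Set.Ioi 0)) (nhds 0) :=
  Real.tendsto_exp_neg_atTop_nhds_zero.comp (tendsto_rpow_neg_nhdsGT_zero (neg_lt_zero.2 hμ))

/-- **Domain of attraction of the Fréchet distribution.**  A CDF `F` is attracted to the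
Fréchet law `H_{f,μ}` (i.e. `F(a_N+b_N x)^N → H_{f,μ}(x)` at continuity points for some
`a_N, b_N > 0`) if and only if `ω_F = sup{z : 1−F(z) > 0} = +∞` and
`(1−F(tx))/(1−F(t)) → x^{−μ}` as `t → ∞`, for all `x > 0`. -/
theorem frechet_domain_of_attraction
    (F : ℝ → ℝ) (hF : IsCDF F) (μ : ℝ) (hμ : 0 < μ) :
    (∃ (a b : ℕ → ℝ), (∀ N, 0 < b N) ∧
        ∀ x : ℝ, ContinuousAt (frechetCDF μ) x →
          Tendsto (fun N : ℕ => F (a N + b N * x) ^ N) atTop (nhds (frechetCDF μ x)))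
    ↔ ((¬ BddAbove {z : ℝ | 0 < 1 - F z}) ∧
        ∀ x : ℝ, 0 < x →
          Tendsto (fun t : ℝ => (1 - F (t * x)) / (1 - F t)) atTop (nhds (x ^ (-μ)))) := by
  constructor
  · rintro ⟨a, b, hb, h⟩
    have htail : ∀ x : ℝ, 0 < x → Tendsto
        (fun n : ℕ => (2 : ℝ) ^ n * (1 - F (a (2 ^ n) + b (2 ^ n) * x))) atTop
        (nhds (x ^ (-μ))) := by
      intro x hx
      have h1 := h x (continuousAt_frechetCDF_of_pos hx)
      rw [frechetCDF_of_pos hx] at h1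
      have h2 := tendsto_mul_one_sub_of_tendsto_pow (fun N => hF.nonneg _) h1
      have h3 := h2.comp (tendsto_pow_atTop_atTop_of_one_lt (one_lt_two (α := ℕ)))
      simpa [Function.comp_def] using h3
    obtain ⟨hp, hBtop, hlim⟩ := tendsto_tail_without_centring (T := fun x => 1 - F x)
      (A := fun n => a (2 ^ n)) (B := fun n => b (2 ^ n)) hμ hF.antitone_tail
      (fun n => hb _) htail
    refine ⟨not_bddAbove_iff.2 fun M => ?_, fun x hx =>
      tendsto_tail_ratio (T := fun x => 1 - F x) (B := fun n => b (2 ^ n))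
        hF.antitone_tail (fun n => hb _) hp hBtop hlim hx⟩
    have h1 := hlim 1 one_pos
    rw [Real.one_rpow] at h1
    obtain ⟨n, hn, hM⟩ := ((h1.eventually (lt_mem_nhds one_pos)).and
      (hBtop.eventually (eventually_gt_atTop M))).exists
    rw [mul_one] at hn
    exact ⟨b (2 ^ n), pos_of_mul_pos_right hn (by positivity), hM⟩
  · rintro ⟨hunb, hrv⟩
    obtain ⟨b, hb, hlim⟩ := hF.exists_scale_of_regular_variation hunb hrv
    have hconv : ∀ x : ℝ, 0 < x →
        Tendsto (fun N : ℕ => F (b N * x) ^ N) atTop (nhds (Real.exp (-x ^ (-μ)))) :=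
      fun x hx => tendsto_pow_of_tendsto_mul_one_sub (hlim x hx)
    refine ⟨fun _ => 0, b, hb, fun x _ => ?_⟩
    simp only [zero_add]
    rcases lt_or_ge 0 x with hx | hx
    · rw [frechetCDF_of_pos hx]
      exact hconv x hx
    · rw [frechetCDF, if_neg hx.not_gt]
      refine tendsto_order.2 ⟨fun c hc => Eventually.of_forall fun N =>
        hc.trans_le (pow_nonneg (hF.nonneg _) N), fun c hc => ?_⟩
      obtain ⟨y, hy, hy0⟩ := (((tendsto_exp_neg_rpow_neg_zero hμ).eventually
        (gt_mem_nhds hc)).and self_mem_nhdsWithin).exists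
      have hy0 : 0 < y := hy0
      filter_upwards [(hconv y hy0).eventually (gt_mem_nhds hy)] with N hN
      refine (pow_le_pow_left₀ (hF.nonneg _) (hF.1 ?_) N).trans_lt hN
      exact mul_le_mul_of_nonneg_left (hx.trans hy0.le) (hb N).le
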